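/- Constrained r-barycenter over a closed convex set: Let (S, Σ, μ) be a σ-finite measure space, 1 < q < ∞, d ≥ 1, X = L^q(S, μ; ℝ^d), and 1 < r < ∞. Let C ⊆ X be a nonempty closed convex subset and let Y be a strongly measurable X-valued random variable with E[‖Y‖_X^r] < ∞. Then there exists a unique c* ∈ C such that E[‖Y − c*‖_X^r] = min_{Z ∈ C} E[‖Y − Z‖_X^r]. -/

import Mathlib

open MeasureTheory Filter Topology
open scoped ENNReal NNReal

theorem norm_add_div_two_rpow_le {E : Type*} [SeminormedAddCommGroup E] {p : ℝ} (hp : 1 ≤ p)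
    (x y : E) : (‖x + y‖ / 2) ^ p ≤ (‖x‖ ^ p + ‖y‖ ^ p) / 2 := by
  have hconv := (convexOn_rpow hp).2 (norm_nonneg x) (norm_nonneg y)
    one_half_pos.le one_half_pos.le (add_halves 1)
  simp only [smul_eq_mul] at hconv
  calc (‖x + y‖ / 2) ^ p ≤ (1 / 2 * ‖x‖ + 1 / 2 * ‖y‖) ^ p := by
        gcongr
        linarith [norm_add_le x y]
    _ ≤ (‖x‖ ^ p + ‖y‖ ^ p) / 2 := by linarith

/-- A quantitative gap in the convexity inequality for `s ↦ s ^ p` between `1` and `s ∈ [0, 1]`,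
provided the midpoint is bounded away from `1`. -/
theorem exists_pos_le_one_add_rpow_div_two_sub {p δ : ℝ} (hp : 1 < p) (hδ : 0 < δ) (hδ' : δ ≤ 1) :
    ∃ c, 0 < c ∧ ∀ s ∈ Set.Icc (0 : ℝ) 1,
      c ≤ (1 + s ^ p) / 2 - min ((1 + s) / 2) (1 - δ) ^ p := by
  have hp0 : 0 ≤ p := by linarith
  have hcont : Continuous fun s : ℝ => (1 + s ^ p) / 2 - min ((1 + s) / 2) (1 - δ) ^ p := by
    have h1 := Real.continuous_rpow_const hp0
    have h2 : Continuous fun s : ℝ => min ((1 + s) / 2) (1 - δ) := by fun_prop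
    have h3 := h1.comp h2
    exact ((continuous_const.add h1).div_const 2).sub h3
  obtain ⟨t, ht, hmin⟩ := isCompact_Icc.exists_isMinOn (Set.nonempty_Icc.2 zero_le_one)
    hcont.continuousOn
  refine ⟨_, ?_, fun s hs => hmin hs⟩
  have hm0 : 0 ≤ min ((1 + t) / 2) (1 - δ) := le_min (by linarith [ht.1]) (by linarith)
  rcases ht.2.lt_or_eq with hlt | rfl
  · have hconv := (strictConvexOn_rpow hp).2 (Set.mem_Ici.2 zero_le_one) (Set.mem_Ici.2 ht.1)
      hlt.ne' one_half_pos one_half_pos (add_halves 1)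
    simp only [smul_eq_mul, Real.one_rpow] at hconv
    have hle : min ((1 + t) / 2) (1 - δ) ^ p ≤ (1 / 2 * 1 + 1 / 2 * t) ^ p :=
      Real.rpow_le_rpow hm0 ((min_le_left _ _).trans (by linarith)) hp0
    linarith
  · have : min ((1 + 1) / 2) (1 - δ) ^ p < 1 :=
      Real.rpow_lt_one hm0 ((min_le_right _ _).trans_lt (by linarith)) (by linarith)
    simp only [Real.one_rpow]
    linarith

/-- In a uniformly convex space, the defect in the midpoint convexity inequality for `‖·‖ ^ p`
controls `‖x - y‖ ^ p`, up to an arbitrarily small multiple of `‖x‖ ^ p + ‖y‖ ^ p`. -/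
theorem exists_norm_sub_rpow_le (E : Type*) [NormedAddCommGroup E] [NormedSpace ℝ E]
    [UniformConvexSpace E] {p ε : ℝ} (hp : 1 < p) (hε : 0 < ε) :
    ∃ K, 0 < K ∧ ∀ x y : E, ‖x - y‖ ^ p ≤ ε * (‖x‖ ^ p + ‖y‖ ^ p) +
      K * ((‖x‖ ^ p + ‖y‖ ^ p) / 2 - (‖x + y‖ / 2) ^ p) := by
  have hp0 : 0 < p := by linarith
  obtain ⟨δ, hδ, hUC⟩ := exists_forall_closed_ball_dist_add_le_two_sub E
    (Real.rpow_pos_of_pos hε p⁻¹)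
  obtain ⟨c, hc, hgap⟩ := exists_pos_le_one_add_rpow_div_two_sub hp
    (lt_min (half_pos hδ) one_pos) (min_le_right (δ / 2) 1)
  have hK : 0 < (2 : ℝ) ^ p / c := by positivity
  have normalized : ∀ x y : E, ‖x‖ = 1 → ‖y‖ ≤ 1 → ‖x - y‖ ^ p ≤ ε * (‖x‖ ^ p + ‖y‖ ^ p) +
      2 ^ p / c * ((‖x‖ ^ p + ‖y‖ ^ p) / 2 - (‖x + y‖ / 2) ^ p) := by
    intro x y hx hy
    have hdefect := norm_add_div_two_rpow_le hp.le x y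
    have hyp : 0 ≤ ‖y‖ ^ p := by positivity
    rcases lt_or_ge ‖x - y‖ (ε ^ p⁻¹) with hlt | hge
    · have h1 : ‖x - y‖ ^ p ≤ ε := by
        calc ‖x - y‖ ^ p ≤ (ε ^ p⁻¹) ^ p := by gcongr
          _ = ε := Real.rpow_inv_rpow hε.le hp0.ne'
      have h2 : 0 ≤ 2 ^ p / c * ((‖x‖ ^ p + ‖y‖ ^ p) / 2 - (‖x + y‖ / 2) ^ p) :=
        mul_nonneg hK.le (by linarith)
      have h3 : 0 ≤ ε * ‖y‖ ^ p := by positivity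
      rw [hx, Real.one_rpow] at h2 ⊢
      linarith
    · have hsum := hUC hx.le hy hge
      have h1 : ‖x + y‖ / 2 ≤ min ((1 + ‖y‖) / 2) (1 - min (δ / 2) 1) := by
        refine le_min (by linarith [norm_add_le x y]) ?_
        linarith [min_le_left (δ / 2) 1]
      have h2 : (‖x + y‖ / 2) ^ p ≤ min ((1 + ‖y‖) / 2) (1 - min (δ / 2) 1) ^ p := by gcongr
      have h3 := hgap ‖y‖ ⟨norm_nonneg y, hy⟩
      have h4 : ‖x - y‖ ^ p ≤ 2 ^ p := by
        gcongr
        linarith [norm_sub_le x y]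
      have h5 : 2 ^ p / c * c ≤ 2 ^ p / c * ((‖x‖ ^ p + ‖y‖ ^ p) / 2 - (‖x + y‖ / 2) ^ p) := by
        gcongr
        rw [hx, Real.one_rpow]
        linarith
      rw [div_mul_cancel₀ _ hc.ne'] at h5
      have h6 : 0 ≤ ε * (‖x‖ ^ p + ‖y‖ ^ p) := by positivity
      linarith
  have ordered : ∀ x y : E, ‖y‖ ≤ ‖x‖ → ‖x - y‖ ^ p ≤ ε * (‖x‖ ^ p + ‖y‖ ^ p) +
      2 ^ p / c * ((‖x‖ ^ p + ‖y‖ ^ p) / 2 - (‖x + y‖ / 2) ^ p) := by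
    intro x y hxy
    rcases eq_or_ne x 0 with rfl | hx
    · have hy : y = 0 := norm_le_zero_iff.1 (by simpa using hxy)
      subst hy
      simp [Real.zero_rpow hp0.ne']
    · have ha : 0 < ‖x‖ := norm_pos_iff.2 hx
      have hscale : ∀ z : E, ‖z‖ = ‖x‖ * ‖‖x‖⁻¹ • z‖ := by
        intro z
        rw [norm_smul, norm_inv, norm_norm, mul_inv_cancel_left₀ ha.ne']
      have hn := normalized (‖x‖⁻¹ • x) (‖x‖⁻¹ • y)
        (by rw [norm_smul, norm_inv, norm_norm, inv_mul_cancel₀ ha.ne'])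
        (by rw [norm_smul, norm_inv, norm_norm, ← div_eq_inv_mul]; exact (div_le_one ha).2 hxy)
      rw [← smul_sub, ← smul_add] at hn
      have hpow : ∀ z : E, ‖z‖ ^ p = ‖x‖ ^ p * ‖‖x‖⁻¹ • z‖ ^ p := by
        intro z
        rw [← Real.mul_rpow ha.le (norm_nonneg _), ← hscale]
      have hpow_half : (‖x + y‖ / 2) ^ p = ‖x‖ ^ p * (‖‖x‖⁻¹ • (x + y)‖ / 2) ^ p := by
        rw [← Real.mul_rpow ha.le (by positivity), ← mul_div_assoc, ← hscale]
      have hm := mul_le_mul_of_nonneg_left hn (Real.rpow_nonneg ha.le p)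
      calc ‖x - y‖ ^ p = ‖x‖ ^ p * ‖‖x‖⁻¹ • (x - y)‖ ^ p := hpow _
        _ ≤ _ := hm
        _ = ε * (‖x‖ ^ p * ‖‖x‖⁻¹ • x‖ ^ p + ‖x‖ ^ p * ‖‖x‖⁻¹ • y‖ ^ p) + 2 ^ p / c *
            ((‖x‖ ^ p * ‖‖x‖⁻¹ • x‖ ^ p + ‖x‖ ^ p * ‖‖x‖⁻¹ • y‖ ^ p) / 2 -
              ‖x‖ ^ p * (‖‖x‖⁻¹ • (x + y)‖ / 2) ^ p) := by ring
        _ = _ := by rw [← hpow, ← hpow, ← hpow_half]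
  refine ⟨_, hK, fun x y => ?_⟩
  rcases le_total ‖y‖ ‖x‖ with h | h
  · exact ordered x y h
  · rw [norm_sub_rev, add_comm (‖x‖ ^ p), add_comm x]
    exact ordered y x h

/-- If the midpoint defect of `‖·‖ ^ p` controls `‖x - y‖ ^ p`, the space is uniformly convex. -/
theorem UniformConvexSpace.of_norm_sub_rpow_le {E : Type*} [NormedAddCommGroup E] {p : ℝ}
    (hp : 1 ≤ p)
    (h : ∀ ε : ℝ, 0 < ε → ∃ K, 0 < K ∧ ∀ x y : E, ‖x - y‖ ^ p ≤ ε * (‖x‖ ^ p + ‖y‖ ^ p) +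
      K * ((‖x‖ ^ p + ‖y‖ ^ p) / 2 - (‖x + y‖ / 2) ^ p)) :
    UniformConvexSpace E := by
  have hp0 : 0 < p := by linarith
  refine ⟨fun ε hε => ?_⟩
  obtain ⟨K, hK, hxy⟩ := h (ε ^ p / 4) (by positivity)
  refine ⟨ε ^ p / (K * p), by positivity, fun x hx y hy hε' => ?_⟩
  have h1 := hxy x y
  have h2 : ε ^ p ≤ ‖x - y‖ ^ p := by gcongr
  have h3 := one_add_mul_self_le_rpow_one_add
    (s := ‖x + y‖ / 2 - 1) (by linarith [norm_nonneg (x + y)]) hp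
  rw [add_sub_cancel] at h3
  simp only [hx, hy, Real.one_rpow] at h1
  have h4 : ε ^ p / 2 ≤ K * (p * (1 - ‖x + y‖ / 2)) :=
    calc ε ^ p / 2 ≤ K * ((1 + 1) / 2 - (‖x + y‖ / 2) ^ p) := by linarith
      _ ≤ K * (p * (1 - ‖x + y‖ / 2)) := by
        gcongr
        linarith
  have h5 : ε ^ p / (K * p) ≤ 2 * (1 - ‖x + y‖ / 2) := by
    rw [div_le_iff₀ (by positivity)]
    linarith
  linarith

theorem MeasureTheory.Lp.norm_rpow_eq_integral {α E : Type*} [MeasurableSpace α] {μ : Measure α}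
    [NormedAddCommGroup E] {p : ℝ≥0∞} (hp0 : p ≠ 0) (hp : p ≠ ∞) (f : Lp E p μ) :
    ‖f‖ ^ p.toReal = ∫ a, ‖f a‖ ^ p.toReal ∂μ := by
  have hp' : 0 < p.toReal := ENNReal.toReal_pos hp0 hp
  have hint : 0 ≤ ∫ a, ‖f a‖ ^ p.toReal ∂μ := integral_nonneg fun a => by positivity
  rw [Lp.norm_def, (Lp.memLp f).eLpNorm_eq_integral_rpow_norm hp0 hp,
    ENNReal.toReal_ofReal (by positivity), Real.rpow_inv_rpow hint hp'.ne']

/-- For `1 < p < ∞`, the Bochner space `L^p` with values in a uniformly convex space is uniformly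
convex. -/
theorem MeasureTheory.Lp.uniformConvexSpace {α E : Type*} [MeasurableSpace α] {μ : Measure α}
    [NormedAddCommGroup E] [NormedSpace ℝ E] [UniformConvexSpace E] {p : ℝ≥0∞} [Fact (1 ≤ p)]
    (hp1 : 1 < p) (hp : p ≠ ∞) : UniformConvexSpace (Lp E p μ) := by
  have hp0 : p ≠ 0 := (zero_lt_one.trans hp1).ne'
  have hpr : 1 < p.toReal := by
    simpa using (ENNReal.toReal_lt_toReal ENNReal.one_ne_top hp).2 hp1
  refine .of_norm_sub_rpow_le hpr.le fun ε hε => ?_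
  obtain ⟨K, hK, h⟩ := exists_norm_sub_rpow_le E hpr hε
  refine ⟨K, hK, fun f g => ?_⟩
  have hint : ∀ f : Lp E p μ, Integrable (fun a => ‖f a‖ ^ p.toReal) μ :=
    fun f => (Lp.memLp f).integrable_norm_rpow hp0 hp
  have hhalf : (‖f + g‖ / 2) ^ p.toReal = ∫ a, ‖(f + g) a‖ ^ p.toReal / 2 ^ p.toReal ∂μ := by
    rw [Real.div_rpow (norm_nonneg _) zero_le_two, integral_div, Lp.norm_rpow_eq_integral hp0 hp]
  have hint_half := (hint (f + g)).div_const (2 ^ p.toReal)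
  have hsum : Integrable (fun a => ‖f a‖ ^ p.toReal + ‖g a‖ ^ p.toReal) μ :=
    (hint f).add (hint g)
  have hdefect : Integrable (fun a => K * ((‖f a‖ ^ p.toReal + ‖g a‖ ^ p.toReal) / 2 -
      ‖(f + g) a‖ ^ p.toReal / 2 ^ p.toReal)) μ :=
    ((hsum.div_const 2).sub hint_half).const_mul K
  rw [hhalf, Lp.norm_rpow_eq_integral hp0 hp f, Lp.norm_rpow_eq_integral hp0 hp g,
    Lp.norm_rpow_eq_integral hp0 hp (f - g), ← integral_add (hint f) (hint g), ← integral_div,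
    ← integral_sub (hsum.div_const 2) hint_half, ← integral_const_mul, ← integral_const_mul,
    ← integral_add (hsum.const_mul ε) hdefect]
  refine integral_mono_ae (hint _) ((hsum.const_mul ε).add hdefect) ?_
  filter_upwards [Lp.coeFn_sub f g, Lp.coeFn_add f g] with a hsub hadd
  have ha := h (f a) (g a)
  rw [Real.div_rpow (norm_nonneg _) zero_le_two] at ha
  simpa only [hsub, hadd, Pi.sub_apply, Pi.add_apply] using ha

/-- In a uniformly convex space, almost nearest points of a convex set are close together. -/
theorem Convex.exists_forall_norm_sub_lt_infDist_add {E : Type*} [NormedAddCommGroup E]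
    [NormedSpace ℝ E] [UniformConvexSpace E] {C : Set E} (hC : Convex ℝ C) (y : E) {ε : ℝ}
    (hε : 0 < ε) :
    ∃ η > 0, ∀ a ∈ C, ∀ b ∈ C, ‖y - a‖ < Metric.infDist y C + η →
      ‖y - b‖ < Metric.infDist y C + η → ‖a - b‖ < ε := by
  set m := Metric.infDist y C with hm
  have hm0 : 0 ≤ m := Metric.infDist_nonneg
  obtain ⟨K, hK, h⟩ := exists_norm_sub_rpow_le E (p := 2) one_lt_two
    (ε := ε ^ 2 / (4 * (m + 1) ^ 2)) (by positivity)
  simp only [Real.rpow_two] at h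
  refine ⟨min 1 (ε ^ 2 / (4 * K * (m + 1))), lt_min one_pos (by positivity),
    fun a ha b hb hya hyb => ?_⟩
  set η := min 1 (ε ^ 2 / (4 * K * (m + 1)))
  have hη0 : 0 < η := lt_min one_pos (by positivity)
  have hη1 : η ≤ 1 := min_le_left _ _
  have hη2 : η * (4 * K * (m + 1)) ≤ ε ^ 2 :=
    (le_div_iff₀ (by positivity)).1 (min_le_right _ _)
  have hmid : m ≤ ‖(y - a) + (y - b)‖ / 2 := by
    have hmem : (1 / 2 : ℝ) • a + (1 / 2 : ℝ) • b ∈ C :=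
      hC ha hb (by norm_num) (by norm_num) (by norm_num)
    have hle := Metric.infDist_le_dist_of_mem (x := y) hmem
    have heq : y - ((1 / 2 : ℝ) • a + (1 / 2 : ℝ) • b) = (1 / 2 : ℝ) • ((y - a) + (y - b)) := by
      module
    rw [dist_eq_norm, heq, norm_smul] at hle
    norm_num at hle
    linarith
  have hmid2 : m ^ 2 ≤ (‖(y - a) + (y - b)‖ / 2) ^ 2 := by gcongr
  have ha2 : ‖y - a‖ ^ 2 < (m + η) ^ 2 := by gcongr
  have hb2 : ‖y - b‖ ^ 2 < (m + η) ^ 2 := by gcongr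
  have hab := h (y - b) (y - a)
  rw [sub_sub_sub_cancel_left, add_comm (y - b)] at hab
  have hfirst : ε ^ 2 / (4 * (m + 1) ^ 2) * (‖y - b‖ ^ 2 + ‖y - a‖ ^ 2) ≤ ε ^ 2 / 2 := by
    calc _ ≤ ε ^ 2 / (4 * (m + 1) ^ 2) * ((m + 1) ^ 2 + (m + 1) ^ 2) := by
          gcongr <;> linarith
      _ = ε ^ 2 / 2 := by field_simp; norm_num
  have hsecond : (‖y - b‖ ^ 2 + ‖y - a‖ ^ 2) / 2 - (‖(y - a) + (y - b)‖ / 2) ^ 2 <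
      η * (2 * (m + 1)) := by nlinarith
  have hsecond' := mul_lt_mul_of_pos_left hsecond hK
  exact lt_of_pow_lt_pow_left₀ 2 hε.le (by nlinarith)

/-- In a uniformly convex Banach space, a nonempty closed convex set has a unique point nearest to
a given point. -/
theorem Convex.existsUnique_forall_norm_sub_le {E : Type*} [NormedAddCommGroup E]
    [NormedSpace ℝ E] [UniformConvexSpace E] [CompleteSpace E] {C : Set E} (hC : Convex ℝ C)
    (hne : C.Nonempty) (hclosed : IsClosed C) (y : E) :
    ∃! c, c ∈ C ∧ ∀ z ∈ C, ‖y - c‖ ≤ ‖y - z‖ := by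
  have hinf : ∀ z ∈ C, Metric.infDist y C ≤ ‖y - z‖ := fun z hz => by
    simpa [dist_eq_norm] using Metric.infDist_le_dist_of_mem (x := y) hz
  have happrox : ∀ η > 0, ∃ z ∈ C, ‖y - z‖ < Metric.infDist y C + η := fun η hη => by
    simpa [dist_eq_norm] using
      (Metric.infDist_lt_iff hne).1 (lt_add_of_pos_right (Metric.infDist y C) hη)
  choose! z hzC hz using fun n : ℕ => happrox (1 / (n + 1)) Nat.one_div_pos_of_nat
  have hcauchy : CauchySeq z := by
    refine Metric.cauchySeq_iff.2 fun ε hε => ?_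
    obtain ⟨η, hη, h⟩ := hC.exists_forall_norm_sub_lt_infDist_add y hε
    obtain ⟨N, hN⟩ := exists_nat_one_div_lt hη
    have hlt : ∀ n ≥ N, ‖y - z n‖ < Metric.infDist y C + η := fun n hn =>
      (hz n).trans (by linarith [Nat.one_div_le_one_div (α := ℝ) hn])
    refine ⟨N, fun i hi j hj => ?_⟩
    rw [dist_eq_norm]
    exact h _ (hzC i) _ (hzC j) (hlt i hi) (hlt j hj)
  obtain ⟨c, hc⟩ := cauchySeq_tendsto_of_complete hcauchy
  have hcC : c ∈ C := hclosed.mem_of_tendsto hc (Eventually.of_forall hzC)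
  have hcm : ‖y - c‖ ≤ Metric.infDist y C := by
    have hlim : Tendsto (fun n : ℕ => Metric.infDist y C + 1 / ((n : ℝ) + 1)) atTop
        (𝓝 (Metric.infDist y C)) := by
      simpa using tendsto_one_div_add_atTop_nhds_zero_nat.const_add (Metric.infDist y C)
    exact le_of_tendsto_of_tendsto' (tendsto_const_nhds.sub hc).norm hlim fun n => (hz n).le
  refine ⟨c, ⟨hcC, fun z hz => hcm.trans (hinf z hz)⟩, fun b ⟨hbC, hb⟩ => ?_⟩
  refine sub_eq_zero.1 (norm_le_zero_iff.1 (le_of_forall_pos_le_add fun ε hε => ?_))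
  obtain ⟨η, hη, h⟩ := hC.exists_forall_norm_sub_lt_infDist_add y hε
  have hlt := h b hbC c hcC (by linarith [hb c hcC]) (by linarith)
  linarith

/-- In a uniformly convex Banach space, a random variable with finite `r`-th moment, `1 < r`, has a
unique `r`-barycenter relative to a nonempty closed convex set. -/
theorem Convex.existsUnique_forall_lintegral_rpow_le {E Ω : Type*} [NormedAddCommGroup E]
    [NormedSpace ℝ E] [UniformConvexSpace E] [CompleteSpace E] [MeasurableSpace Ω] {P : Measure Ω}
    [IsProbabilityMeasure P] {r : ℝ} (hr : 1 < r) {C : Set E} (hC : Convex ℝ C)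
    (hne : C.Nonempty) (hclosed : IsClosed C) {Y : Ω → E} (hY : AEStronglyMeasurable Y P)
    (hmom : ∫⁻ ω, ‖Y ω‖ₑ ^ r ∂P < ∞) :
    ∃! c, c ∈ C ∧ ∀ z ∈ C, ∫⁻ ω, ‖Y ω - c‖ₑ ^ r ∂P ≤ ∫⁻ ω, ‖Y ω - z‖ₑ ^ r ∂P := by
  have hr0 : 0 < r := by linarith
  set p := ENNReal.ofReal r with hp
  have hp1 : 1 < p := ENNReal.one_lt_ofReal.2 hr
  have hp0 : p ≠ 0 := (zero_lt_one.trans hp1).ne'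
  have hptop : p ≠ ∞ := ENNReal.ofReal_ne_top
  have hpr : p.toReal = r := ENNReal.toReal_ofReal hr0.le
  have : Fact (1 ≤ p) := ⟨hp1.le⟩
  have : UniformConvexSpace (Lp E p P) := Lp.uniformConvexSpace hp1 hptop
  have hYp : MemLp Y p P :=
    ⟨hY, (eLpNorm_lt_top_iff_lintegral_rpow_enorm_lt_top hp0 hptop).2 (by rwa [hpr])⟩
  have hnorm : ∀ z, ‖hYp.toLp Y - Lp.const p P z‖ =
      ((∫⁻ ω, ‖Y ω - z‖ₑ ^ r ∂P) ^ (1 / r)).toReal := by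
    intro z
    rw [← MemLp.toLp_const, ← MemLp.toLp_sub, Lp.norm_toLp,
      eLpNorm_eq_lintegral_rpow_enorm_toReal hp0 hptop, hpr]
    rfl
  have hfin : ∀ z, ∫⁻ ω, ‖Y ω - z‖ₑ ^ r ∂P ≠ ∞ := by
    intro z
    have := lintegral_rpow_enorm_lt_top_of_eLpNorm_lt_top hp0 hptop
      (hYp.sub (memLp_const z)).eLpNorm_lt_top
    rw [hpr] at this
    exact this.ne
  have hle : ∀ c z, ‖hYp.toLp Y - Lp.const p P c‖ ≤ ‖hYp.toLp Y - Lp.const p P z‖ ↔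
      ∫⁻ ω, ‖Y ω - c‖ₑ ^ r ∂P ≤ ∫⁻ ω, ‖Y ω - z‖ₑ ^ r ∂P := by
    intro c z
    have hr1 : 0 < 1 / r := by positivity
    rw [hnorm, hnorm, ENNReal.toReal_le_toReal
      (ENNReal.rpow_ne_top_of_nonneg hr1.le (hfin c))
      (ENNReal.rpow_ne_top_of_nonneg hr1.le (hfin z)), ENNReal.rpow_le_rpow_iff hr1]
  have hiso : Isometry (Lp.constL p P ℝ : E →L[ℝ] Lp E p P) :=
    AddMonoidHomClass.isometry_of_norm _ fun z => by
      change ‖Lp.const p P z‖ = ‖z‖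
      simp [Lp.norm_const (p := p) (μ := P) (c := z) hp0]
  obtain ⟨_, ⟨⟨c, hc, rfl⟩, hmin⟩, huniq⟩ :=
    (hC.linear_image
      (Lp.constL p P ℝ : E →L[ℝ] Lp E p P).toLinearMap).existsUnique_forall_norm_sub_le (hne.image _)
      (hiso.isClosedEmbedding.isClosedMap _ hclosed) (hYp.toLp Y)
  refine ⟨c, ⟨hc, fun z hz => (hle c z).1 (hmin _ ⟨z, hz, rfl⟩)⟩, fun b ⟨hb, hbmin⟩ => ?_⟩
  refine hiso.injective (huniq _ ⟨⟨b, hb, rfl⟩, ?_⟩)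
  rintro _ ⟨z, hz, rfl⟩
  exact (hle b z).2 (hbmin z hz)

/-- **Constrained `r`-barycenter over a closed convex set.** Let
`X = L^q(S, μ; ℝ^d)` with `(S, μ)` σ-finite, `1 < q < ∞`, `1 < r < ∞`, and let
`C ⊆ X` be a nonempty closed convex set. If `Y` is a strongly measurable
`X`-valued random variable with `E ‖Y‖ ^ r < ∞`, then there is a unique
`cstar ∈ C` minimizing `Z ↦ E ‖Y - Z‖ ^ r` over `C`. -/
theorem constrained_r_barycenter_Lq
    {S : Type*} [MeasurableSpace S] (μ : Measure S) [SigmaFinite μ]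
    (q : ℝ≥0∞) [Fact (1 ≤ q)] (hq1 : 1 < q) (hq2 : q ≠ ∞)
    (d : ℕ) (hd : 1 ≤ d)
    {Ω : Type*} [MeasurableSpace Ω] (P : Measure Ω) [IsProbabilityMeasure P]
    (r : ℝ) (hr : 1 < r)
    (C : Set (Lp (EuclideanSpace ℝ (Fin d)) q μ))
    (hCne : C.Nonempty) (hCclosed : IsClosed C) (hCconvex : Convex ℝ C)
    (Y : Ω → Lp (EuclideanSpace ℝ (Fin d)) q μ) (hY : StronglyMeasurable Y)
    (hmom : ∫⁻ ω, (‖Y ω‖₊ : ℝ≥0∞) ^ r ∂P < ∞) :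
    ∃ cstar ∈ C,
      (∀ Z ∈ C, ∫⁻ ω, (‖Y ω - cstar‖₊ : ℝ≥0∞) ^ r ∂P ≤
        ∫⁻ ω, (‖Y ω - Z‖₊ : ℝ≥0∞) ^ r ∂P) ∧
      ∀ c' ∈ C,
        (∀ Z ∈ C, ∫⁻ ω, (‖Y ω - c'‖₊ : ℝ≥0∞) ^ r ∂P ≤
          ∫⁻ ω, (‖Y ω - Z‖₊ : ℝ≥0∞) ^ r ∂P) → c' = cstar := by
  have : UniformConvexSpace (Lp (EuclideanSpace ℝ (Fin d)) q μ) := Lp.uniformConvexSpace hq1 hq2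
  obtain ⟨c, ⟨hc, hmin⟩, huniq⟩ := hCconvex.existsUnique_forall_lintegral_rpow_le hr hCne hCclosed
    hY.aestronglyMeasurable hmom
  exact ⟨c, hc, hmin, fun c' hc' hmin' => huniq c' ⟨hc', hmin'⟩⟩
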